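/- There is no Borel function ψ : 2^ℕ → 2^ℕ such that for every S ⊆ 2^ℕ: if S is an n-splitting family for every n ≥ 1, then the image ψ(S) is a σ-splitting family. (Hence there is no Borel Tukey morphism from 𝔰_{<ω} to 𝔰_σ.) -/

import Mathlib

/-- `c ∈ 2^ℕ` splits the infinite set `A ⊆ ℕ`: both `{k ∈ A | c k = false}`
and `{k ∈ A | c k = true}` are infinite. -/
def Splits (c : ℕ → Bool) (A : Set ℕ) : Prop :=
  {k ∈ A | c k = false}.Infinite ∧ {k ∈ A | c k = true}.Infinite

/-- `S ⊆ 2^ℕ` is an `n`-splitting family: for all infinite `A_1, …, A_n ⊆ ℕ`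
some `c ∈ S` splits every `A_i`. -/
def NSplitting (n : ℕ) (S : Set (ℕ → Bool)) : Prop :=
  ∀ A : Fin n → Set ℕ, (∀ i, (A i).Infinite) → ∃ c ∈ S, ∀ i, Splits c (A i)

/-- `S ⊆ 2^ℕ` is a σ-splitting family: for every sequence `⟨A_k⟩` of infinite
subsets of ℕ some `c ∈ S` splits every `A_k`. -/
def SigmaSplitting (S : Set (ℕ → Bool)) : Prop :=
  ∀ A : ℕ → Set ℕ, (∀ k, (A k).Infinite) → ∃ c ∈ S, ∀ k, Splits c (A k)

open Set Filter Topology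

theorem exists_cyl {U : Set (ℕ → Bool)} (hU : IsOpen U) {x : ℕ → Bool} (hx : x ∈ U) :
    ∃ n : ℕ, ∀ y : ℕ → Bool, (∀ m < n, y m = x m) → y ∈ U := by
  obtain ⟨v, ⟨z, n, rfl⟩, hxv, hvU⟩ :=
    (PiNat.isTopologicalBasis_cylinders (fun _ : ℕ => Bool)).exists_subset_of_mem_open hx hU
  refine ⟨n, fun y hy => hvU ?_⟩
  rw [PiNat.mem_cylinder_iff] at hxv ⊢
  intro i hi
  rw [hy i hi, hxv i hi]

theorem residual_inf (A : Set ℕ) (hA : A.Infinite) (b : Bool) :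
    {c : ℕ → Bool | {k ∈ A | c k = b}.Infinite} ∈ residual (ℕ → Bool) := by
  have h1 : ∀ n : ℕ, {c : ℕ → Bool | ∃ k ∈ A, n < k ∧ c k = b} ∈ residual (ℕ → Bool) := by
    intro n
    apply residual_of_dense_open
    · have : {c : ℕ → Bool | ∃ k ∈ A, n < k ∧ c k = b}
          = ⋃ k ∈ {k | k ∈ A ∧ n < k}, (fun c : ℕ → Bool => c k) ⁻¹' {b} := by
        ext c; simp [and_assoc]
      rw [this]
      exact isOpen_biUnion fun k _ => (isOpen_discrete _).preimage (continuous_apply k)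
    · rw [dense_iff_inter_open]
      rintro U hU ⟨x, hx⟩
      obtain ⟨N, hN⟩ := exists_cyl hU hx
      obtain ⟨k, hkA, hk⟩ := hA.exists_gt (max n N)
      have h1 : n < k := lt_of_le_of_lt (le_max_left _ _) hk
      have h2 : N < k := lt_of_le_of_lt (le_max_right _ _) hk
      refine ⟨Function.update x k b, hN _ ?_, k, hkA, h1, by simp⟩
      intro m hm
      rw [Function.update_of_ne (by omega)]
  filter_upwards [eventually_countable_forall.2 h1] with c hc
  refine Set.infinite_of_forall_exists_gt fun n => ?_
  obtain ⟨k, hk, hn, hb⟩ := hc n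
  exact ⟨k, ⟨hk, hb⟩, hn⟩

theorem residual_splits (A : Set ℕ) (hA : A.Infinite) :
    {c : ℕ → Bool | Splits c A} ∈ residual (ℕ → Bool) := by
  filter_upwards [residual_inf A hA false, residual_inf A hA true] with c h1 h2
  exact ⟨h1, h2⟩

theorem splits_congr {c d : ℕ → Bool} {A E : Set ℕ} (h : Splits d (A \ E))
    (hcd : ∀ m, m ∉ E → c m = d m) : Splits c A := by
  refine ⟨h.1.mono ?_, h.2.mono ?_⟩ <;>
  · rintro k ⟨⟨hk, hE⟩, hd⟩
    exact ⟨hk, by rw [hcd k hE, hd]⟩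

theorem unif {U : Set (ℕ → Bool)} (hU : IsOpen U) (n : ℕ)
    (h : ∀ x : ℕ → Bool, ∃ y ∈ U, ∀ m < n, y m = x m) :
    ∃ n' > n, ∀ x : ℕ → Bool, ∃ t : ℕ → Bool, (∀ m < n, t m = x m) ∧
      ∀ y : ℕ → Bool, (∀ m < n', y m = t m) → y ∈ U := by
  have h1 : ∀ s : Fin n → Bool, ∃ (t : ℕ → Bool) (l : ℕ), (∀ m : Fin n, t m = s m) ∧
      ∀ y : ℕ → Bool, (∀ m < l, y m = t m) → y ∈ U := by
    intro s
    obtain ⟨y, hy, hs⟩ := h (fun m => if hm : m < n then s ⟨m, hm⟩ else false)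
    obtain ⟨l, hl⟩ := exists_cyl hU hy
    exact ⟨y, l, fun m => by rw [hs m m.2]; simp, hl⟩
  choose t l ht hl using h1
  refine ⟨max (n+1) (Finset.univ.sup l), lt_of_lt_of_le (Nat.lt_succ_self n) (le_max_left _ _), ?_⟩
  intro x
  refine ⟨t (fun m => x m), fun m hm => ht (fun m => x m) ⟨m, hm⟩, fun y hy => hl (fun m => x m) y ?_⟩
  intro m hm
  apply hy
  have : l (fun m : Fin n => x m) ≤ Finset.univ.sup l := Finset.le_sup (Finset.mem_univ _)
  exact lt_of_lt_of_le (lt_of_lt_of_le hm this) (le_max_right _ _)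

theorem unif2 {O : ℕ → Set (ℕ → Bool)} (hO : ∀ i, IsOpen (O i))
    (h : ∀ (x : ℕ → Bool) (n : ℕ), ∀ᶠ i in atTop, ∃ y ∈ O i, ∀ m < n, y m = x m)
    {V : Set (ℕ → Bool)} (hV : IsOpen V) (hVd : Dense V) (n L : ℕ) :
    ∃ i ≥ L, ∃ n' > n, ∀ x : ℕ → Bool, ∃ t : ℕ → Bool, (∀ m < n, t m = x m) ∧
      ∀ y : ℕ → Bool, (∀ m < n', y m = t m) → y ∈ O i ∩ V := by
  have h1 : ∀ s : Fin n → Bool, ∀ᶠ i in atTop, ∃ y ∈ O i, ∀ m : Fin n, y m = s m := by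
    intro s
    filter_upwards [h (fun m => if hm : m < n then s ⟨m, hm⟩ else false) n] with i hi
    obtain ⟨y, hy, hs⟩ := hi
    exact ⟨y, hy, fun m => by rw [hs m m.2]; simp⟩
  obtain ⟨i, hi, hiL⟩ := ((eventually_all.2 h1).and (eventually_ge_atTop L)).exists
  refine ⟨i, hiL, unif ((hO i).inter hV) n ?_⟩
  intro x
  obtain ⟨y, hy, hs⟩ := hi (fun m => x m)
  obtain ⟨z, ⟨hz1, hz2⟩, hz3⟩ := hVd.inter_open_nonempty (O i ∩ PiNat.cylinder y n)
    ((hO i).inter (PiNat.isOpen_cylinder _ y n)) ⟨y, hy, PiNat.self_mem_cylinder y n⟩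
  refine ⟨z, ⟨hz1, hz3⟩, fun m hm => ?_⟩
  rw [PiNat.mem_cylinder_iff] at hz2
  rw [hz2 m hm]
  exact hs ⟨m, hm⟩

theorem fusion {nn : ℕ → ℕ} (hnn : StrictMono nn) {W : ℕ → Set (ℕ → Bool)}
    (f : ℕ → (ℕ → Bool) → (ℕ → Bool)) (hf1 : ∀ j x, ∀ m < nn j, f j x m = x m)
    (hf2 : ∀ j x y, (∀ m < nn (j+1), y m = f j x m) → y ∈ W j)
    (K : Set ℕ) (d : ℕ → Bool) :
    ∃ c : ℕ → Bool, (∀ j ∈ K, c ∈ W j) ∧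
      ∀ j ∉ K, ∀ m, nn j ≤ m → m < nn (j+1) → c m = d m := by
  classical
  let F : ℕ → (ℕ → Bool) := fun j => Nat.rec d
    (fun j x => if j ∈ K then (fun m => if m < nn (j+1) then f j x m else d m) else x) j
  have hF : ∀ j, F (j+1) =
    if j ∈ K then (fun m => if m < nn (j+1) then f j (F j) m else d m) else F j := fun j => rfl
  have hd : ∀ j m, nn j ≤ m → F j m = d m := by
    intro j
    induction j with
    | zero => intro m _; rfl
    | succ j ih =>
      intro m hm
      rw [hF]
      split_ifs with hK
      · simp [not_lt.2 hm]
      · exact ih m ((hnn (Nat.lt_succ_self j)).le.trans hm)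
  have hs : ∀ j m, m < nn j → F (j+1) m = F j m := by
    intro j m hm
    rw [hF]
    split_ifs with hK
    · simp [hm.trans (hnn (Nat.lt_succ_self j)), hf1 j _ m hm]
    · rfl
  have hs2 : ∀ j l m, j ≤ l → m < nn j → F l m = F j m := by
    intro j l m hjl hm
    induction l, hjl using Nat.le_induction with
    | base => rfl
    | succ l hl ih => rw [hs l m (lt_of_lt_of_le hm (hnn.monotone hl)), ih]
  have hc : ∀ j m, m < nn j → F (m+1) m = F j m := by
    intro j m hm
    have hm' : m < nn (m+1) := lt_of_lt_of_le (Nat.lt_succ_self m) hnn.le_apply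
    rcases le_total j (m+1) with h | h
    · exact hs2 _ _ _ h hm
    · exact (hs2 _ _ _ h hm').symm
  refine ⟨fun m => F (m+1) m, fun j hj => hf2 j (F j) _ fun m hm => ?_, fun j hj m h1 h2 => ?_⟩
  · show F (m+1) m = _
    rw [hc (j+1) m hm, hF]
    simp [hj, hm]
  · show F (m+1) m = _
    rw [hc (j+1) m h2, hF]
    simp only [hj, if_false]
    exact hd j m h1

theorem block {nn : ℕ → ℕ} (hnn : StrictMono nn) (h0 : nn 0 = 0) (m : ℕ) :
    ∃ j, nn j ≤ m ∧ m < nn (j+1) := by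
  induction m with
  | zero => exact ⟨0, by omega, by have := hnn (show 0 < 0 + 1 by omega); omega⟩
  | succ m ih =>
    obtain ⟨j, h1, h2⟩ := ih
    by_cases h : m + 1 < nn (j+1)
    · exact ⟨j, by omega, h⟩
    · exact ⟨j+1, by omega, by have := hnn (show j + 1 < j + 1 + 1 by omega); omega⟩

theorem block_unique {nn : ℕ → ℕ} (hnn : StrictMono nn) {m j j' : ℕ}
    (h1 : nn j ≤ m) (h2 : m < nn (j+1)) (h1' : nn j' ≤ m) (h2' : m < nn (j'+1)) : j = j' := by
  have a := hnn.lt_iff_lt.1 (h1.trans_lt h2')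
  have b := hnn.lt_iff_lt.1 (h1'.trans_lt h2)
  omega

theorem exists_splitter {n : ℕ} (A : Fin n → Set ℕ) (hA : ∀ i, (A i).Infinite)
    {G : Set (ℕ → Bool)} (hG : G ∈ residual (ℕ → Bool)) {U : Set (ℕ → Bool)}
    (hU : IsOpen U) (hne : U.Nonempty) : ∃ c ∈ U, c ∈ G ∧ ∀ i, Splits c (A i) := by
  have h : G ∩ {c | ∀ i, Splits c (A i)} ∈ residual (ℕ → Bool) :=
    inter_mem hG (eventually_countable_forall.2 fun i => residual_splits (A i) (hA i))
  obtain ⟨c, h1, h2, h3⟩ := (dense_of_mem_residual h).inter_open_nonempty U hU hne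
  exact ⟨c, h1, h2, h3⟩

/-- There is no Borel `ψ : 2^ℕ → 2^ℕ` carrying every family that is
`n`-splitting for all `n ≥ 1` to a σ-splitting family.
(No Borel Tukey morphism from 𝔰_{<ω} to 𝔰_σ.) -/
theorem stmt14 :
    ¬ ∃ ψ : (ℕ → Bool) → (ℕ → Bool),
      Measurable ψ ∧
      ∀ S : Set (ℕ → Bool), (∀ n : ℕ, 1 ≤ n → NSplitting n S) →
        SigmaSplitting (ψ '' S) := by
  rintro ⟨ψ, hψ, H⟩
  have hO : ∀ i : ℕ, ∃ u : Set (ℕ → Bool), IsOpen u ∧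
      {c | ψ c i = true} =ᶠ[residual (ℕ → Bool)] u := by
    intro i
    have : MeasurableSet {c | ψ c i = true} :=
      (measurable_pi_apply i).comp hψ (measurableSet_singleton true)
    exact this.residualEq_isOpen
  choose O hOo hOe using hO
  have hGr : {c | ∀ i, (ψ c i = true ↔ c ∈ O i)} ∈ residual (ℕ → Bool) := by
    refine eventually_countable_forall.2 fun i => ?_
    filter_upwards [hOe i] with c hc
    exact iff_of_eq hc
  obtain ⟨G, hGs, hGδ, hGd⟩ := mem_residual.1 hGr
  have hGres : G ∈ residual (ℕ → Bool) := residual_of_dense_Gδ hGδ hGd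
  by_cases hcase : ∀ (x : ℕ → Bool) (n : ℕ), ∀ᶠ i in atTop, ∃ y ∈ O i, ∀ m < n, y m = x m
  · obtain ⟨U, hUo, hUG⟩ := hGδ.eq_iInter_nat
    let V : ℕ → Set (ℕ → Bool) := fun j => ⋂ m ∈ Set.Iic j, U m
    have hVo : ∀ j, IsOpen (V j) := fun j =>
      (Set.finite_Iic j).isOpen_biInter fun m _ => hUo m
    have hVd : ∀ j, Dense (V j) := fun j => hGd.mono (by
      rw [hUG]
      exact fun c hc => mem_iInter₂.2 fun m _ => mem_iInter.1 hc m)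
    have step := fun j n L => unif2 hOo hcase (hVo j) (hVd j) n L
    choose I hI N hN f hf1 hf2 using step
    let p : ℕ → ℕ × ℕ := fun j => Nat.rec (0, 0)
      (fun j q => (N j q.1 q.2, I j q.1 q.2 + 1)) j
    have hp : ∀ j, p (j+1) = (N j (p j).1 (p j).2, I j (p j).1 (p j).2 + 1) := fun j => rfl
    let nn : ℕ → ℕ := fun j => (p j).1
    let ii : ℕ → ℕ := fun j => I j (p j).1 (p j).2
    have hnn : StrictMono nn := strictMono_nat_of_lt_succ fun j => by
      show (p j).1 < (p (j+1)).1
      rw [hp]; exact hN _ _ _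
    have hii : StrictMono ii := strictMono_nat_of_lt_succ fun j => by
      have : (p (j+1)).2 ≤ ii (j+1) := hI _ _ _
      rw [hp] at this
      exact this
    let K : ℕ → Set ℕ := fun k => {j | (Nat.unpair j).1 = k}
    have hK : ∀ k, (K k).Infinite := fun k => by
      refine Set.infinite_of_injective_forall_mem (f := fun l => Nat.pair k l) ?_ ?_
      · intro a b hab
        simpa using hab
      · intro a; simp [K]
    let E : ℕ → Set ℕ := fun k => {m | ∃ j ∈ K k, nn j ≤ m ∧ m < nn (j+1)}
    have hB : ∀ k, (ii '' K k).Infinite := fun k => (hK k).image hii.injective.injOn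
    obtain ⟨_, ⟨c, hc, rfl⟩, hsp⟩ := H
      {c | ∃ k, ∀ b ∈ ii '' K k, ψ c b = true} (by
        intro n _ A hA
        have hk : ∃ k, ∀ i, (A i \ E k).Infinite := by
          by_contra! hcon
          choose g hg using hcon
          obtain ⟨k, k', hkk, hgg⟩ := Finite.exists_ne_map_eq_of_infinite g
          have hg' := hg k'
          rw [← hgg] at hg'
          refine hA (g k) (((hg k).union hg').subset ?_)
          intro m hm
          by_cases h1 : m ∈ E k
          · right
            refine ⟨hm, ?_⟩
            rintro ⟨j', hj', h1', h2'⟩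
            obtain ⟨j, hj, h1, h2⟩ := h1
            have := block_unique hnn h1 h2 h1' h2'
            subst this
            exact hkk (hj.symm.trans hj')
          · exact Or.inl ⟨hm, h1⟩
        obtain ⟨k, hk⟩ := hk
        obtain ⟨d, -, -, hd⟩ := exists_splitter (fun i => A i \ E k) hk hGres isOpen_univ
          Set.univ_nonempty
        obtain ⟨c, hc1, hc2⟩ := fusion hnn (W := fun j => O (ii j) ∩ V j)
          (fun j x => f j (p j).1 (p j).2 x) (fun j x => hf1 j _ _ x)
          (fun j x y hy => hf2 j _ _ x y hy) (K k) d
        have hcG : c ∈ G := by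
          rw [hUG, mem_iInter]
          intro m
          obtain ⟨j, hj, hmj⟩ := (hK k).exists_gt m
          exact mem_iInter₂.1 (hc1 j hj).2 m hmj.le
        refine ⟨c, ⟨k, ?_⟩, fun i => splits_congr (hd i) fun m hm => ?_⟩
        · rintro _ ⟨j, hj, rfl⟩
          exact (hGs hcG (ii j)).2 (hc1 j hj).1
        · obtain ⟨j, h1, h2⟩ := block hnn rfl m
          exact hc2 j (fun hj => hm ⟨j, hj, h1, h2⟩) m h1 h2)
      (fun k => ii '' K k) hB
    obtain ⟨k, hk⟩ := hc
    obtain ⟨b, hb, hb'⟩ := (hsp k).1.nonempty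
    rw [hk b hb] at hb'
    exact absurd hb' (by decide)
  · push Not at hcase
    obtain ⟨x, n, hx⟩ := hcase
    have hinf : {i | ∀ y ∈ O i, ∃ m < n, y m ≠ x m}.Infinite :=
      Nat.frequently_atTop_iff_infinite.1 hx
    obtain ⟨_, ⟨c, ⟨hc1, hc2⟩, rfl⟩, hsp⟩ := H (PiNat.cylinder x n ∩ G) (by
        intro k _ A hA
        obtain ⟨c, h1, h2, h3⟩ := exists_splitter A hA hGres (PiNat.isOpen_cylinder _ x n)
          ⟨x, PiNat.self_mem_cylinder x n⟩
        exact ⟨c, ⟨h1, h2⟩, h3⟩)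
      (fun _ => {i | ∀ y ∈ O i, ∃ m < n, y m ≠ x m}) (fun _ => hinf)
    obtain ⟨i, hi, hit⟩ := (hsp 0).2.nonempty
    obtain ⟨m, hm, hne⟩ := hi c ((hGs hc2 i).1 hit)
    exact hne (PiNat.mem_cylinder_iff.1 hc1 m hm)
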